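/- arXiv:2505.12971 — 5 statements merged into one kernel-verified Lean document; each statement's English description precedes it below -/
import Mathlib

section
/- Under the conditional memorylessness assumption, the observed process is conditionally Markov of order 1: for every k ≥ 1, every states i, j, i_{k-1}, …, i_1 ∈ S and every covariate value z with P(Z = z) > 0, one has P(Y_{k+1} = j | Y_k = i, Y_{k-1} = i_{k-1}, …, Y_1 = i_1, Z = z) = P(Y_{k+1} = j | Y_k = i, Z = z), whenever the conditioning events have positive probability. -/
open MeasureTheory ProbabilityTheory

/-- The measure of a measurable set is the sum of the measures of its traces on the fibres of a
countably valued measurable map. -/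
theorem tsum_measure_inter_preimage_singleton {Ω ι : Type*} [MeasurableSpace Ω] [Countable ι]
    [MeasurableSpace ι] [MeasurableSingletonClass ι] (μ : Measure Ω) {X : Ω → ι}
    (hX : Measurable X) {T : Set Ω} (hT : MeasurableSet T) :
    ∑' x, μ (T ∩ X ⁻¹' {x}) = μ T := by
  rw [← measure_iUnion (fun x y hxy => (Set.disjoint_singleton.2 hxy).preimage X
      |>.mono Set.inter_subset_right Set.inter_subset_right)
      fun x => hT.inter (hX (measurableSet_singleton x)),
    ← Set.inter_iUnion, ← Set.preimage_iUnion, Set.iUnion_of_singleton, Set.preimage_univ,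
    Set.inter_univ]

/-- If the conditional probability of `T` given `A ∩ {X = x}` is the same for every value `x` of a
countably valued `X`, it is also the conditional probability of `T` given `A`. -/
theorem cond_eq_of_forall_cond_inter_preimage_singleton {Ω ι : Type*} [MeasurableSpace Ω]
    [Countable ι] [MeasurableSpace ι] [MeasurableSingletonClass ι] (μ : Measure Ω)
    [IsFiniteMeasure μ] {X : Ω → ι} (hX : Measurable X) {A T : Set Ω} (hT : MeasurableSet T)
    (hA : μ A ≠ 0) (c : ENNReal)
    (h : ∀ x, μ (A ∩ X ⁻¹' {x}) ≠ 0 → μ[T | A ∩ X ⁻¹' {x}] = c) :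
    μ[T | A] = c := by
  have fiber (x : ι) : μ.restrict A (T ∩ X ⁻¹' {x}) = c * μ.restrict A (Set.univ ∩ X ⁻¹' {x}) := by
    have hx : MeasurableSet (X ⁻¹' {x}) := hX (measurableSet_singleton x)
    rw [Measure.restrict_apply (hT.inter hx), Measure.restrict_apply (MeasurableSet.univ.inter hx),
      Set.univ_inter, Set.inter_comm _ A, Set.inter_comm _ A]
    by_cases h0 : μ (A ∩ X ⁻¹' {x}) = 0
    · rw [h0, mul_zero]
      exact measure_mono_null (Set.inter_subset_inter_right A Set.inter_subset_right) h0
    · rw [← h x h0, cond_apply' hT, mul_comm, ← mul_assoc,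
        ENNReal.mul_inv_cancel h0 (measure_ne_top _ _), one_mul]
      congr 1
      ext ω
      simp only [Set.mem_inter_iff]
      tauto
  have total : μ (A ∩ T) = c * μ A := by
    rw [Set.inter_comm, ← Measure.restrict_apply hT,
      ← tsum_measure_inter_preimage_singleton _ hX hT, tsum_congr fiber, ENNReal.tsum_mul_left,
      tsum_measure_inter_preimage_singleton _ hX MeasurableSet.univ, Measure.restrict_apply_univ]
  rw [cond_apply' hT, total, mul_comm c, ← mul_assoc,
    ENNReal.inv_mul_cancel hA (measure_ne_top _ _), one_mul]

/-- Under the conditional memorylessness assumption (Assumption 2 of the paper),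
the observed process `(Y_k)` is conditionally Markov of order 1 given the covariate. -/
theorem observed_process_cond_markov
    {Ω 𝒵 : Type*} [MeasurableSpace Ω] [MeasurableSpace 𝒵]
    (P : Measure Ω) [IsProbabilityMeasure P]
    (S : ℕ) (hS : 1 ≤ S)
    (Y : ℕ → Ω → Fin S) (τ : ℕ → Ω → ℕ) (Z : Ω → 𝒵)
    (hYmeas : ∀ k, Measurable (Y k)) (hτmeas : ∀ k, Measurable (τ k))
    (hZmeas : Measurable Z)
    (hτpos : ∀ k ω, 1 ≤ τ k ω)
    -- Assumption 2 (conditional memorylessness)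
    (hmem : ∀ (k : ℕ), 1 ≤ k → ∀ (i j : Fin S) (hist : ℕ → Fin S) (ℓ : ℕ)
      (gaps : ℕ → ℕ) (z : 𝒵),
      P {ω | Y k ω = i ∧ (∀ r, 1 ≤ r → r ≤ k → τ r ω = gaps r) ∧
          (∀ r, 1 ≤ r → r < k → Y r ω = hist r) ∧ Z ω = z} ≠ 0 →
      P[{ω | Y (k + 1) ω = j ∧ τ (k + 1) ω = ℓ} |
        {ω | Y k ω = i ∧ (∀ r, 1 ≤ r → r ≤ k → τ r ω = gaps r) ∧
          (∀ r, 1 ≤ r → r < k → Y r ω = hist r) ∧ Z ω = z}]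
      = P[{ω | Y (k + 1) ω = j ∧ τ (k + 1) ω = ℓ} | {ω | Y k ω = i ∧ Z ω = z}]) :
    -- Conclusion: the observed process is conditionally Markov of order 1
    ∀ (k : ℕ), 1 ≤ k → ∀ (i j : Fin S) (hist : ℕ → Fin S) (z : 𝒵),
      P {ω | Z ω = z} ≠ 0 →
      P {ω | Y k ω = i ∧ Z ω = z} ≠ 0 →
      P {ω | Y k ω = i ∧ (∀ r, 1 ≤ r → r < k → Y r ω = hist r) ∧ Z ω = z} ≠ 0 →
      P[{ω | Y (k + 1) ω = j} |
        {ω | Y k ω = i ∧ (∀ r, 1 ≤ r → r < k → Y r ω = hist r) ∧ Z ω = z}]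
      = P[{ω | Y (k + 1) ω = j} | {ω | Y k ω = i ∧ Z ω = z}] := by
  intro k hk i j hist z _ _ hA
  have hT : MeasurableSet {ω | Y (k + 1) ω = j} := hYmeas (k + 1) (measurableSet_singleton j)
  have hG : Measurable fun ω (r : Finset.Icc 1 k) => τ r ω :=
    measurable_pi_lambda _ fun r => hτmeas r
  refine cond_eq_of_forall_cond_inter_preimage_singleton P hG hT hA _ fun g hg => ?_
  let gaps : ℕ → ℕ := fun r => if h : r ∈ Finset.Icc 1 k then g ⟨r, h⟩ else 0
  have hset : {ω | Y k ω = i ∧ (∀ r, 1 ≤ r → r < k → Y r ω = hist r) ∧ Z ω = z} ∩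
        (fun ω (r : Finset.Icc 1 k) => τ r ω) ⁻¹' {g} =
      {ω | Y k ω = i ∧ (∀ r, 1 ≤ r → r ≤ k → τ r ω = gaps r) ∧
        (∀ r, 1 ≤ r → r < k → Y r ω = hist r) ∧ Z ω = z} := by
    ext ω
    have hgaps : (fun r : Finset.Icc 1 k => τ r ω) = g ↔
        ∀ r, 1 ≤ r → r ≤ k → τ r ω = gaps r := by
      simp +contextual [funext_iff, gaps]
    simp only [Set.mem_inter_iff, Set.mem_ofPred_eq, Set.mem_preimage, Set.mem_singleton_iff, hgaps]
    tauto
  rw [hset] at hg ⊢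
  rw [← tsum_measure_inter_preimage_singleton _ (hτmeas (k + 1)) hT,
    ← tsum_measure_inter_preimage_singleton _ (hτmeas (k + 1)) hT]
  exact tsum_congr fun ℓ => hmem k hk i j hist ℓ gaps z hg
end

section
/- Under Assumptions 1–4, for every positive integer ℓ, every covariate value z with P(Z = z) > 0 and every k ≥ 1 for which P(τ_{k+1} = ℓ, Y_k = i, Z = z) > 0 for all i ∈ S, the matrix A_ℓ(z) with entries (A_ℓ(z))_{ij} = P(Y_{k+1} = j, τ_{k+1} = ℓ | Y_k = i, Z = z) / P(τ_{k+1} = ℓ | Y_k = i, Z = z) does not depend on k and equals the ℓ-th matrix power P(z)^ℓ of the conditional transition matrix P(z). -/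
open MeasureTheory ProbabilityTheory Finset

/-- A measure of a (not necessarily measurable) set splits along the fibres of a measurable
`ℕ`-valued map. -/
lemma measure_eq_tsum_inter_fiber {Ω : Type*} [MeasurableSpace Ω] (P : Measure Ω)
    {N : Ω → ℕ} (hN : Measurable N) (A : Set Ω) :
    P A = ∑' t, P (A ∩ {ω | N ω = t}) := by
  have hmeas (t : ℕ) : MeasurableSet {ω | N ω = t} := hN (measurableSet_singleton t)
  have hcover : ⋃ t, {ω | N ω = t} = Set.univ := by
    ext ω
    simp
  have hdisj : Pairwise (Function.onFun Disjoint fun t => {ω | N ω = t}) := by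
    intro s t hst
    exact Set.disjoint_left.mpr fun ω hs ht => hst (hs.symm.trans ht)
  calc P A = P.restrict A (⋃ t, {ω | N ω = t}) := by
        rw [hcover, Measure.restrict_apply_univ]
    _ = ∑' t, P.restrict A {ω | N ω = t} := measure_iUnion hdisj hmeas
    _ = ∑' t, P (A ∩ {ω | N ω = t}) := by
        simp_rw [Measure.restrict_apply (hmeas _), Set.inter_comm]

/-- Sampling a measurable family of maps at a measurable `ℕ`-valued time is measurable. -/
lemma measurable_sample {Ω α : Type*} [MeasurableSpace Ω] [MeasurableSpace α]
    {X : ℕ → Ω → α} (hX : ∀ t, Measurable (X t)) {N : Ω → ℕ} (hN : Measurable N) :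
    Measurable fun ω => X (N ω) ω :=
  (measurable_from_prod_countable_right hX : Measurable fun p : ℕ × Ω => X p.1 p.2).comp
    (hN.prodMk measurable_id)

/-- If `P[B | A] = c` whenever `P A ≠ 0`, then `P (A ∩ B) = c * P A`. -/
lemma measure_inter_eq_mul_of_cond_eq {Ω : Type*} [MeasurableSpace Ω] (P : Measure Ω)
    [IsFiniteMeasure P] {A B : Set Ω} (hB : MeasurableSet B) {c : ENNReal}
    (h : P A ≠ 0 → P[B | A] = c) : P (A ∩ B) = c * P A := by
  by_cases hA : P A = 0
  · rw [hA, mul_zero]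
    exact measure_mono_null Set.inter_subset_left hA
  · rw [← h hA, cond_apply' hB, mul_comm, ← mul_assoc,
      ENNReal.mul_inv_cancel hA (measure_ne_top P A), one_mul]

/-- Under Assumptions 1–4 of the paper, the matrix `A_ℓ(z)` with entries
`P(Y_{k+1} = j, τ_{k+1} = ℓ | Y_k = i, Z = z) / P(τ_{k+1} = ℓ | Y_k = i, Z = z)`
does not depend on `k` and equals the ℓ-th power `P(z)^ℓ` of the conditional
transition matrix. -/
theorem A_ell_eq_matrix_power
    {Ω 𝒵 : Type*} [MeasurableSpace Ω] [MeasurableSpace 𝒵]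
    (P : Measure Ω) [IsProbabilityMeasure P]
    (S : ℕ) (hS : 1 ≤ S)
    (X : ℕ → Ω → Fin S) (T : ℕ → Ω → ℕ) (Z : Ω → 𝒵)
    (Pmat : 𝒵 → Matrix (Fin S) (Fin S) ENNReal)
    (hstoch : ∀ z i, ∑ j, Pmat z i j = 1)
    (hT0 : ∀ ω, T 0 ω = 0) (hTmono : ∀ ω, StrictMono fun k => T k ω)
    (τ : ℕ → Ω → ℕ) (hτ : ∀ k ω, τ k ω = T k ω - T (k - 1) ω)
    (Y : ℕ → Ω → Fin S) (hY : ∀ k ω, Y k ω = X (T k ω) ω)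
    (hXmeas : ∀ t, Measurable (X t)) (hTmeas : ∀ k, Measurable (T k))
    (hZmeas : Measurable Z)
    -- Assumption 1 (homogeneous conditional transitions)
    (hassump1 : ∀ (t : ℕ) (i j : Fin S) (z : 𝒵),
      P {ω | X t ω = i ∧ Z ω = z} ≠ 0 →
      P[{ω | X (t + 1) ω = j} | {ω | X t ω = i ∧ Z ω = z}] = Pmat z i j)
    -- Assumption 2 (conditional memorylessness)
    (hassump2 : ∀ (k : ℕ), 1 ≤ k → ∀ (i j : Fin S) (hist : ℕ → Fin S) (ℓ : ℕ)
      (gaps : ℕ → ℕ) (z : 𝒵),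
      P {ω | Y k ω = i ∧ (∀ r, 1 ≤ r → r ≤ k → τ r ω = gaps r) ∧
          (∀ r, 1 ≤ r → r < k → Y r ω = hist r) ∧ Z ω = z} ≠ 0 →
      P[{ω | Y (k + 1) ω = j ∧ τ (k + 1) ω = ℓ} |
        {ω | Y k ω = i ∧ (∀ r, 1 ≤ r → r ≤ k → τ r ω = gaps r) ∧
          (∀ r, 1 ≤ r → r < k → Y r ω = hist r) ∧ Z ω = z}]
      = P[{ω | Y (k + 1) ω = j ∧ τ (k + 1) ω = ℓ} | {ω | Y k ω = i ∧ Z ω = z}])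
    -- Assumption 3 (conditional power-transition)
    (hassump3 : ∀ (t t' : ℕ), t < t' → ∀ (k : ℕ) (i j : Fin S) (z : 𝒵),
      P {ω | X (T k ω) ω = i ∧ T (k + 1) ω = t' ∧ T k ω = t ∧ Z ω = z} ≠ 0 →
      P[{ω | X (T (k + 1) ω) ω = j} |
        {ω | X (T k ω) ω = i ∧ T (k + 1) ω = t' ∧ T k ω = t ∧ Z ω = z}]
      = (Pmat z ^ (t' - t)) i j)
    -- Assumption 4 (conditional stationarity of the gap distribution)
    (hassump4 : ∀ (k k' : ℕ) (i : Fin S) (ℓ : ℕ) (z : 𝒵),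
      P {ω | Y k ω = i ∧ Z ω = z} ≠ 0 →
      P {ω | Y k' ω = i ∧ Z ω = z} ≠ 0 →
      P[{ω | τ (k + 1) ω = ℓ} | {ω | Y k ω = i ∧ Z ω = z}]
      = P[{ω | τ (k' + 1) ω = ℓ} | {ω | Y k' ω = i ∧ Z ω = z}]) :
    -- Conclusion: for every admissible k, A_ℓ(z) = P(z)^ℓ (hence A_ℓ(z) is independent of k)
    ∀ (ℓ : ℕ), 1 ≤ ℓ → ∀ z : 𝒵, P {ω | Z ω = z} ≠ 0 →
      ∀ (k : ℕ), 1 ≤ k →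
      (∀ i : Fin S, P {ω | τ (k + 1) ω = ℓ ∧ Y k ω = i ∧ Z ω = z} ≠ 0) →
      ∀ i j : Fin S,
        P[{ω | Y (k + 1) ω = j ∧ τ (k + 1) ω = ℓ} | {ω | Y k ω = i ∧ Z ω = z}] /
          P[{ω | τ (k + 1) ω = ℓ} | {ω | Y k ω = i ∧ Z ω = z}]
        = (Pmat z ^ ℓ) i j := by
  intro ℓ hℓ z _ k _ hpos i j
  have hYmeas : Measurable (Y (k + 1)) := by
    rw [funext (hY (k + 1))]
    exact measurable_sample hXmeas (hTmeas _)
  have hτmeas : Measurable (τ (k + 1)) := by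
    rw [funext (hτ (k + 1))]
    exact (hTmeas _).sub (hTmeas _)
  have hB : MeasurableSet {ω | Y (k + 1) ω = j} := hYmeas (measurableSet_singleton j)
  have hC : MeasurableSet {ω | τ (k + 1) ω = ℓ} := hτmeas (measurableSet_singleton ℓ)
  set A : Set Ω := {ω | Y k ω = i ∧ Z ω = z}
  have hfiber (t : ℕ) : A ∩ {ω | τ (k + 1) ω = ℓ} ∩ {ω | T k ω = t} =
      {ω | X (T k ω) ω = i ∧ T (k + 1) ω = t + ℓ ∧ T k ω = t ∧ Z ω = z} := by
    ext ω
    have hlt : T k ω < T (k + 1) ω := hTmono ω k.lt_succ_self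
    simp only [A, Set.mem_inter_iff, Set.mem_ofPred_eq, hY, hτ, Nat.add_sub_cancel]
    constructor
    · rintro ⟨⟨⟨hi, hz⟩, hgap⟩, ht⟩
      exact ⟨hi, by omega, ht, hz⟩
    · rintro ⟨hi, ht', ht, hz⟩
      exact ⟨⟨⟨hi, hz⟩, by omega⟩, ht⟩
  have key : P (A ∩ {ω | τ (k + 1) ω = ℓ} ∩ {ω | Y (k + 1) ω = j}) =
      (Pmat z ^ ℓ) i j * P (A ∩ {ω | τ (k + 1) ω = ℓ}) := by
    rw [measure_eq_tsum_inter_fiber P (hTmeas k),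
      measure_eq_tsum_inter_fiber P (hTmeas k) (A ∩ {ω | τ (k + 1) ω = ℓ}),
      ← ENNReal.tsum_mul_left]
    refine tsum_congr fun t => ?_
    rw [Set.inter_right_comm]
    refine measure_inter_eq_mul_of_cond_eq P hB fun hne => ?_
    rw [hfiber t] at hne ⊢
    simpa only [hY, Nat.add_sub_cancel_left] using
      hassump3 t (t + ℓ) (by omega) k i j z hne
  have hAC : P (A ∩ {ω | τ (k + 1) ω = ℓ}) ≠ 0 := by
    convert hpos i using 2
    ext ω
    exact and_comm
  have hden : P[{ω | τ (k + 1) ω = ℓ} | A] ≠ 0 := by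
    rw [cond_apply' hC]
    exact mul_ne_zero (ENNReal.inv_ne_zero.mpr (measure_ne_top P A)) hAC
  have hnum : P[{ω | Y (k + 1) ω = j ∧ τ (k + 1) ω = ℓ} | A] =
      (Pmat z ^ ℓ) i j * P[{ω | τ (k + 1) ω = ℓ} | A] := by
    have hset : A ∩ {ω | Y (k + 1) ω = j ∧ τ (k + 1) ω = ℓ} =
        A ∩ {ω | τ (k + 1) ω = ℓ} ∩ {ω | Y (k + 1) ω = j} := by
      rw [Set.inter_assoc, Set.inter_comm {ω | τ (k + 1) ω = ℓ}]
      rfl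
    have hBC : MeasurableSet {ω | Y (k + 1) ω = j ∧ τ (k + 1) ω = ℓ} := hB.inter hC
    rw [cond_apply' hBC, cond_apply' hC, hset, key, mul_left_comm]
  rw [hnum]
  exact ENNReal.mul_div_cancel_right hden (measure_ne_top _ _)
end

section
/- (Lemma 1 of the paper.) Suppose Assumption 1 holds, T_0 = 0 is non-random, the sequence (τ_k)_{k≥1} is conditionally independent of the process X given Z, and, for every covariate value z with P(Z = z) > 0, the positive-integer-valued variables τ_k, k ≥ 1, are conditionally independent and identically distributed given Z = z. Then Assumptions 2, 3 and 4 hold: (i) P(Y_{k+1} = j, τ_{k+1} = ℓ | Y_k = i, τ_k = ℓ'_k, Y_{k−1} = i_{k−1}, …, Y_1 = i_1, τ_1 = ℓ'_1, Z = z) = P(Y_{k+1} = j, τ_{k+1} = ℓ | Y_k = i, Z = z) for all admissible conditioning events of positive probability; (ii) P(X_{T_{k+1}} = j | X_{T_k} = i, T_{k+1} = t′, T_k = t, Z = z) = (P(z)^{t′−t})_{ij} for all 0 ≤ t < t′; (iii) the conditional distribution of τ_{k+1} given Y_k and Z = z is the same for all k. -/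
open MeasureTheory ProbabilityTheory Finset

section Helpers

variable {Ω : Type*} {S : ℕ}

/-- `E` is determined by the gaps `τ_0, …, τ_k` and by the path of `X` up to time
`τ_1 + ⋯ + τ_k`. -/
def IsPastEvent (τ : ℕ → Ω → ℕ) (X : ℕ → Ω → Fin S) (k : ℕ) (E : Set Ω) : Prop :=
  ∀ ω ω', ω ∈ E → (∀ r < k + 1, τ r ω = τ r ω') →
    (∀ r < (∑ r ∈ Finset.Icc 1 k, τ r ω) + 1, X r ω = X r ω') → ω' ∈ E

/-- The gaps `τ_0, …, τ_k` together with the path of `X` up to time `τ_1 + ⋯ + τ_k`. -/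
def pastCode (τ : ℕ → Ω → ℕ) (X : ℕ → Ω → Fin S) (k : ℕ) (ω : Ω) :
    List ℕ × List (Fin S) :=
  ((List.range (k + 1)).map (fun r => τ r ω),
    (List.range ((∑ r ∈ Finset.Icc 1 k, τ r ω) + 1)).map (fun r => X r ω))

lemma pastCode_eq_iff (τ : ℕ → Ω → ℕ) (X : ℕ → Ω → Fin S) (k : ℕ) (ω ω' : Ω) :
    pastCode τ X k ω' = pastCode τ X k ω ↔ (∀ r < k + 1, τ r ω' = τ r ω) ∧
      ∀ r < (∑ r ∈ Finset.Icc 1 k, τ r ω) + 1, X r ω' = X r ω := by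
  have key : (∀ r < k + 1, τ r ω' = τ r ω) →
      ∑ r ∈ Finset.Icc 1 k, τ r ω' = ∑ r ∈ Finset.Icc 1 k, τ r ω := fun h =>
    Finset.sum_congr rfl fun r hr => h r (by have := Finset.mem_Icc.1 hr; omega)
  simp only [pastCode, Prod.mk.injEq, List.map_inj_left, List.mem_range]
  refine and_congr_right fun h => ?_
  rw [key h]
  simp [List.map_inj_left]

lemma IsPastEvent.inter_fiber {τ : ℕ → Ω → ℕ} {X : ℕ → Ω → Fin S} {k : ℕ} {E : Set Ω}
    (hE : IsPastEvent τ X k E) (w : List ℕ × List (Fin S)) :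
    E ∩ pastCode τ X k ⁻¹' {w} = ∅ ∨
      ∃ ω ∈ E, E ∩ pastCode τ X k ⁻¹' {w} = pastCode τ X k ⁻¹' {pastCode τ X k ω} := by
  rcases (E ∩ pastCode τ X k ⁻¹' {w}).eq_empty_or_nonempty with h | ⟨ω, hω, rfl⟩
  · exact Or.inl h
  · refine Or.inr ⟨ω, hω, Set.inter_eq_right.2 fun ω' hω' => ?_⟩
    obtain ⟨h1, h2⟩ := (pastCode_eq_iff τ X k ω ω').1 hω'
    exact hE ω ω' hω (fun r hr => (h1 r hr).symm) fun r hr => (h2 r hr).symm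

lemma eq_iUnion_inter_fiber {ι : Type*} (f : Ω → ι) (E : Set Ω) :
    E = ⋃ w, E ∩ f ⁻¹' {w} := by
  ext ω; simp

variable [MeasurableSpace Ω]

lemma measurableSet_fiber_pastCode {τ : ℕ → Ω → ℕ} {X : ℕ → Ω → Fin S}
    (hτ : ∀ k, Measurable (τ k)) (hX : ∀ t, Measurable (X t)) (k : ℕ)
    (w : List ℕ × List (Fin S)) : MeasurableSet (pastCode τ X k ⁻¹' {w}) := by
  rcases (pastCode τ X k ⁻¹' {w}).eq_empty_or_nonempty with h | ⟨ω, rfl⟩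
  · rw [h]; exact MeasurableSet.empty
  · have : pastCode τ X k ⁻¹' {pastCode τ X k ω} =
        (⋂ r, ⋂ (_ : r < k + 1), τ r ⁻¹' {τ r ω}) ∩
        ⋂ r, ⋂ (_ : r < (∑ r ∈ Finset.Icc 1 k, τ r ω) + 1), X r ⁻¹' {X r ω} := by
      ext ω'
      simp [pastCode_eq_iff]
    rw [this]
    exact (MeasurableSet.iInter fun r => MeasurableSet.iInter fun _ =>
        hτ r (measurableSet_singleton _)).inter
      (MeasurableSet.iInter fun r => MeasurableSet.iInter fun _ =>
        hX r (measurableSet_singleton _))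

lemma IsPastEvent.measurableSet_inter_fiber {τ : ℕ → Ω → ℕ} {X : ℕ → Ω → Fin S}
    (hτ : ∀ k, Measurable (τ k)) (hX : ∀ t, Measurable (X t)) {k : ℕ} {E : Set Ω}
    (hE : IsPastEvent τ X k E) (w : List ℕ × List (Fin S)) :
    MeasurableSet (E ∩ pastCode τ X k ⁻¹' {w}) := by
  rcases hE.inter_fiber w with h | ⟨ω, -, h⟩
  · rw [h]; exact MeasurableSet.empty
  · rw [h]; exact measurableSet_fiber_pastCode hτ hX k _

lemma IsPastEvent.measurableSet {τ : ℕ → Ω → ℕ} {X : ℕ → Ω → Fin S}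
    (hτ : ∀ k, Measurable (τ k)) (hX : ∀ t, Measurable (X t)) {k : ℕ} {E : Set Ω}
    (hE : IsPastEvent τ X k E) : MeasurableSet E := by
  rw [eq_iUnion_inter_fiber (pastCode τ X k) E]
  exact MeasurableSet.iUnion fun w => hE.measurableSet_inter_fiber hτ hX w

/-- If the conditional probability of `D` given each atom of a past event `E` is `q`, then so is
the conditional probability of `D` given `E`. -/
lemma IsPastEvent.measure_inter_eq {τ : ℕ → Ω → ℕ} {X : ℕ → Ω → Fin S}
    (hτ : ∀ k, Measurable (τ k)) (hX : ∀ t, Measurable (X t)) (μ : Measure Ω) {k : ℕ}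
    {E D : Set Ω} (hE : IsPastEvent τ X k E) (hD : MeasurableSet D) {q : ENNReal}
    (h : ∀ ω ∈ E, μ (pastCode τ X k ⁻¹' {pastCode τ X k ω} ∩ D) =
      μ (pastCode τ X k ⁻¹' {pastCode τ X k ω}) * q) :
    μ (E ∩ D) = μ E * q := by
  have hdisj : Pairwise (Function.onFun Disjoint fun w => E ∩ pastCode τ X k ⁻¹' {w}) := by
    intro w w' hw
    rw [Function.onFun, Set.disjoint_left]
    rintro ω ⟨-, rfl⟩ ⟨-, h2⟩
    exact hw h2
  have hm := hE.measurableSet_inter_fiber hτ hX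
  conv_lhs => rw [eq_iUnion_inter_fiber (pastCode τ X k) E, Set.iUnion_inter]
  conv_rhs => rw [eq_iUnion_inter_fiber (pastCode τ X k) E]
  rw [measure_iUnion hdisj hm, measure_iUnion
    (fun w w' hw => (hdisj hw).mono Set.inter_subset_left Set.inter_subset_left)
    fun w => (hm w).inter hD, ← ENNReal.tsum_mul_right]
  refine tsum_congr fun w => ?_
  rcases hE.inter_fiber w with h0 | ⟨ω, hω, h0⟩
  · simp [h0]
  · rw [h0, h ω hω]

/-- The one-step Markov property implies the `n`-step one. -/
lemma measure_history_inter_eq_pow {X : ℕ → Ω → Fin S} (hX : ∀ t, Measurable (X t))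
    (μ : Measure Ω) (M : Matrix (Fin S) (Fin S) ENNReal)
    (h : ∀ (t : ℕ) (x : ℕ → Fin S) (j : Fin S),
      μ ({ω | ∀ r < t + 1, X r ω = x r} ∩ {ω | X (t + 1) ω = j}) =
        μ {ω | ∀ r < t + 1, X r ω = x r} * M (x t) j)
    (n t : ℕ) (x : ℕ → Fin S) (j : Fin S) :
    μ ({ω | ∀ r < t + 1, X r ω = x r} ∩ {ω | X (t + n) ω = j}) =
      μ {ω | ∀ r < t + 1, X r ω = x r} * (M ^ n) (x t) j := by
  induction n generalizing t x with
  | zero =>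
    rw [pow_zero, Matrix.one_apply]
    split_ifs with hj
    · rw [mul_one]
      congr 1
      ext ω
      simp only [Set.mem_inter_iff, Set.mem_ofPred_eq, add_zero, and_iff_left_iff_imp]
      intro hω
      rw [hω t (by omega), hj]
    · rw [mul_zero]
      convert measure_empty (μ := μ)
      ext ω
      simp only [Set.mem_inter_iff, Set.mem_ofPred_eq, add_zero, Set.mem_empty_iff_false,
        iff_false, not_and]
      intro hω hj'
      exact hj (by rw [← hω t (by omega), hj'])
  | succ n ih =>
    have hstep : ∀ i, {ω | ∀ r < t + 1 + 1, X r ω = Function.update x (t + 1) i r} =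
        {ω | ∀ r < t + 1, X r ω = x r} ∩ {ω | X (t + 1) ω = i} := by
      intro i
      ext ω
      simp only [Set.mem_inter_iff, Set.mem_ofPred_eq]
      rw [Nat.forall_lt_succ_right]
      refine and_congr (forall₂_congr fun r hr => ?_) (by simp)
      rw [Function.update_of_ne (by omega)]
    have hsplit : {ω | ∀ r < t + 1, X r ω = x r} ∩ {ω | X (t + (n + 1)) ω = j} =
        ⋃ i, ({ω | ∀ r < t + 1 + 1, X r ω = Function.update x (t + 1) i r} ∩
          {ω | X (t + 1 + n) ω = j}) := by
      simp_rw [hstep]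
      ext ω
      simp [show t + (n + 1) = t + 1 + n by omega]
    have hm : ∀ i, MeasurableSet
        ({ω | ∀ r < t + 1 + 1, X r ω = Function.update x (t + 1) i r} ∩
          {ω | X (t + 1 + n) ω = j}) := by
      intro i
      refine MeasurableSet.inter ?_ (hX _ (measurableSet_singleton j))
      simp only [Set.ofPred_forall]
      exact MeasurableSet.iInter fun r => MeasurableSet.iInter fun _ =>
        hX r (measurableSet_singleton _)
    rw [hsplit, measure_iUnion _ hm, tsum_fintype, pow_succ', Matrix.mul_apply, Finset.mul_sum]
    · refine Finset.sum_congr rfl fun i _ => ?_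
      rw [ih, hstep, h, Function.update_self, mul_assoc]
    · intro i i' hi
      rw [Function.onFun, Set.disjoint_left]
      rintro ω ⟨h1, -⟩ ⟨h2, -⟩
      rw [hstep] at h1 h2
      exact hi (h1.2.symm.trans h2.2)

/-- The joint law of the next gap and the next observation given a past event on which the current
observation is `i`. -/
lemma IsPastEvent.measure_inter_next {τ : ℕ → Ω → ℕ} {X : ℕ → Ω → Fin S}
    (hτ : ∀ k, Measurable (τ k)) (hX : ∀ t, Measurable (X t))
    (hτpos : ∀ k ω, 1 ≤ τ k ω) (μ : Measure Ω) (M : Matrix (Fin S) (Fin S) ENNReal)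
    (hmarkov : ∀ (t : ℕ) (x : ℕ → Fin S) (j : Fin S),
      μ ({ω | ∀ r < t + 1, X r ω = x r} ∩ {ω | X (t + 1) ω = j}) =
        μ {ω | ∀ r < t + 1, X r ω = x r} * M (x t) j)
    (hindep : ∀ (F G : Finset ℕ) (gaps : ℕ → ℕ) (xs : ℕ → Fin S),
      μ {ω | (∀ r ∈ F, τ r ω = gaps r) ∧ (∀ t ∈ G, X t ω = xs t)}
      = μ {ω | ∀ r ∈ F, τ r ω = gaps r} * μ {ω | ∀ t ∈ G, X t ω = xs t})
    (hiid : ∀ (F : Finset ℕ) (gaps : ℕ → ℕ),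
      μ {ω | ∀ r ∈ F, τ r ω = gaps r} = ∏ r ∈ F, μ {ω | τ r ω = gaps r})
    {k : ℕ} {E : Set Ω} (hE : IsPastEvent τ X k E) {i : Fin S}
    (hi : ∀ ω ∈ E, X (∑ r ∈ Finset.Icc 1 k, τ r ω) ω = i) (ℓ : ℕ) (j : Fin S) :
    μ (E ∩ {ω | X (∑ r ∈ Finset.Icc 1 (k + 1), τ r ω) ω = j ∧ τ (k + 1) ω = ℓ}) =
      μ E * (μ {ω | τ (k + 1) ω = ℓ} * (M ^ ℓ) i j) := by
  rcases Nat.eq_zero_or_pos ℓ with rfl | hℓ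
  · have h0 : ∀ ω, τ (k + 1) ω ≠ 0 := fun ω => by have := hτpos (k + 1) ω; omega
    simp [h0]
  have hD : MeasurableSet
      {ω | X (∑ r ∈ Finset.Icc 1 (k + 1), τ r ω) ω = j ∧ τ (k + 1) ω = ℓ} := by
    refine IsPastEvent.measurableSet hτ hX (k := k + 1) fun ω ω' hω h1 h2 => ?_
    have hs : ∑ r ∈ Finset.Icc 1 (k + 1), τ r ω = ∑ r ∈ Finset.Icc 1 (k + 1), τ r ω' :=
      Finset.sum_congr rfl fun r hr => h1 r (by have := Finset.mem_Icc.1 hr; omega)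
    refine ⟨?_, (h1 _ (by omega)).symm.trans hω.2⟩
    rw [← hs, ← h2 _ (by omega), hω.1]
  refine hE.measure_inter_eq hτ hX μ hD fun ω₀ hω₀ => ?_
  set t := ∑ r ∈ Finset.Icc 1 k, τ r ω₀ with ht
  have hatom : pastCode τ X k ⁻¹' {pastCode τ X k ω₀} =
      {ω | (∀ r ∈ Finset.range (k + 1), τ r ω = τ r ω₀) ∧
        ∀ r ∈ Finset.range (t + 1), X r ω = X r ω₀} := by
    ext ω
    simp [pastCode_eq_iff, ht]
  have hnext : pastCode τ X k ⁻¹' {pastCode τ X k ω₀} ∩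
      {ω | X (∑ r ∈ Finset.Icc 1 (k + 1), τ r ω) ω = j ∧ τ (k + 1) ω = ℓ} =
      {ω | (∀ r ∈ insert (k + 1) (Finset.range (k + 1)),
          τ r ω = Function.update (fun r => τ r ω₀) (k + 1) ℓ r) ∧
        ∀ r ∈ insert (t + ℓ) (Finset.range (t + 1)),
          X r ω = Function.update (fun r => X r ω₀) (t + ℓ) j r} := by
    have hu1 : ∀ r ∈ Finset.range (k + 1),
        Function.update (fun r => τ r ω₀) (k + 1) ℓ r = τ r ω₀ := fun r hr =>
      Function.update_of_ne (by have := Finset.mem_range.1 hr; omega) _ _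
    have hu2 : ∀ r ∈ Finset.range (t + 1),
        Function.update (fun r => X r ω₀) (t + ℓ) j r = X r ω₀ := fun r hr =>
      Function.update_of_ne (by have := Finset.mem_range.1 hr; omega) _ _
    ext ω
    simp only [hatom, Set.mem_inter_iff, Set.mem_ofPred_eq, Finset.forall_mem_insert,
      Function.update_self]
    have hs : (∀ r ∈ Finset.range (k + 1), τ r ω = τ r ω₀) → τ (k + 1) ω = ℓ →
        ∑ r ∈ Finset.Icc 1 (k + 1), τ r ω = t + ℓ := by
      intro h1 h2
      rw [Finset.sum_Icc_succ_top (by omega), h2, ht]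
      congr 1
      exact Finset.sum_congr rfl fun r hr =>
        h1 r (by have := Finset.mem_Icc.1 hr; exact Finset.mem_range.2 (by omega))
    constructor
    · rintro ⟨⟨h1, h2⟩, h3, h4⟩
      rw [hs h1 h4] at h3
      exact ⟨⟨h4, fun r hr => (h1 r hr).trans (hu1 r hr).symm⟩, h3,
        fun r hr => (h2 r hr).trans (hu2 r hr).symm⟩
    · rintro ⟨⟨h4, h1⟩, h3, h2⟩
      have h1' : ∀ r ∈ Finset.range (k + 1), τ r ω = τ r ω₀ := fun r hr =>
        (h1 r hr).trans (hu1 r hr)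
      refine ⟨⟨h1', fun r hr => (h2 r hr).trans (hu2 r hr)⟩, ?_, h4⟩
      rw [hs h1' h4]
      exact h3
  have hpath : {ω | ∀ r ∈ insert (t + ℓ) (Finset.range (t + 1)),
      X r ω = Function.update (fun r => X r ω₀) (t + ℓ) j r} =
      {ω | ∀ r < t + 1, X r ω = X r ω₀} ∩ {ω | X (t + ℓ) ω = j} := by
    ext ω
    simp only [Set.mem_inter_iff, Set.mem_ofPred_eq, Finset.forall_mem_insert,
      Function.update_self, Finset.mem_range]
    rw [and_comm]
    refine and_congr_left fun _ => forall₂_congr fun r hr => ?_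
    rw [Function.update_of_ne (by omega)]
  rw [hnext, hatom, hindep, hindep, hiid, hiid, hpath,
    measure_history_inter_eq_pow hX μ M hmarkov ℓ t (fun r => X r ω₀) j, hi ω₀ hω₀,
    Finset.prod_insert (by simp), Function.update_self]
  have hp : ∏ r ∈ Finset.range (k + 1),
      μ {ω | τ r ω = Function.update (fun r => τ r ω₀) (k + 1) ℓ r} =
      ∏ r ∈ Finset.range (k + 1), μ {ω | τ r ω = τ r ω₀} :=
    Finset.prod_congr rfl fun r hr => by
      rw [Function.update_of_ne (by have := Finset.mem_range.1 hr; omega)]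
  rw [hp]
  simp only [Finset.mem_range]
  ring

lemma sum_pow_apply_eq_one {M : Matrix (Fin S) (Fin S) ENNReal} (hM : ∀ i, ∑ j, M i j = 1)
    (n : ℕ) (i : Fin S) : ∑ j, (M ^ n) i j = 1 := by
  induction n generalizing i with
  | zero => simp [Matrix.one_apply]
  | succ n ih =>
    simp only [pow_succ', Matrix.mul_apply]
    rw [Finset.sum_comm]
    simp [← Finset.mul_sum, ih, hM]

lemma measure_inter_eq_of_cond_apply (P : Measure Ω) [IsFiniteMeasure P] {B E A : Set Ω}
    (hE : MeasurableSet E) (hA : MeasurableSet A) {q : ENNReal}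
    (h : P (E ∩ B) ≠ 0 → P[A | E ∩ B] = q) : P[E ∩ A | B] = P[E | B] * q := by
  rw [cond_apply' (hE.inter hA), cond_apply' hE, mul_assoc]
  congr 1
  rw [Set.inter_comm B E, ← Set.inter_assoc, Set.inter_comm B E]
  by_cases h0 : P (E ∩ B) = 0
  · rw [h0, zero_mul]
    exact measure_mono_null Set.inter_subset_left h0
  · rw [← h h0, cond_apply' hA, ← mul_assoc, ENNReal.mul_inv_cancel h0 (measure_ne_top _ _),
      one_mul]

lemma cond_apply_eq_of_measure_inter (P : Measure Ω) [IsFiniteMeasure P] {B E A : Set Ω}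
    (hE : MeasurableSet E) (hA : MeasurableSet A) {q : ENNReal} (h0 : P (E ∩ B) ≠ 0)
    (h : P[E ∩ A | B] = P[E | B] * q) : P[A | E ∩ B] = q := by
  have hB : P B ≠ 0 := fun hB => h0 (measure_mono_null Set.inter_subset_right hB)
  rw [cond_apply' (hE.inter hA), cond_apply' hE, mul_assoc,
    ENNReal.mul_right_inj (ENNReal.inv_ne_zero.2 (measure_ne_top _ _)) (ENNReal.inv_ne_top.2 hB),
    ← Set.inter_assoc, Set.inter_comm B E] at h
  rw [cond_apply' hA, h, ← mul_assoc, ENNReal.inv_mul_cancel h0 (measure_ne_top _ _), one_mul]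

end Helpers

/-- Lemma 1 of the paper: if `X` is conditionally Markov given `Z` (Assumption 1),
`T_0 = 0` is non-random, the gaps `(τ_k)` are conditionally independent of `X`
given `Z`, and the `τ_k` are conditionally i.i.d. given `Z = z`, then Assumptions 2,
3 and 4 of the paper hold. -/
theorem lemma1_assumptions_2_3_4
    {Ω 𝒵 : Type*} [MeasurableSpace Ω] [MeasurableSpace 𝒵]
    (P : Measure Ω) [IsProbabilityMeasure P]
    (S : ℕ) (hS : 1 ≤ S)
    (X : ℕ → Ω → Fin S) (τ : ℕ → Ω → ℕ) (Z : Ω → 𝒵)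
    (Pmat : 𝒵 → Matrix (Fin S) (Fin S) ENNReal)
    (hstoch : ∀ z i, ∑ j, Pmat z i j = 1)
    (hτpos : ∀ k ω, 1 ≤ τ k ω)
    (T : ℕ → Ω → ℕ) (hT : ∀ k ω, T k ω = ∑ r ∈ Finset.Icc 1 k, τ r ω)
    (Y : ℕ → Ω → Fin S) (hY : ∀ k ω, Y k ω = X (T k ω) ω)
    (hXmeas : ∀ t, Measurable (X t)) (hτmeas : ∀ k, Measurable (τ k))
    (hZmeas : Measurable Z)
    -- Assumption 1: given Z = z, X is a homogeneous Markov chain of order 1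
    -- with transition matrix P(z)
    (hassump1 : ∀ (t : ℕ) (i j : Fin S) (hist : ℕ → Fin S) (z : 𝒵),
      P {ω | X t ω = i ∧ (∀ r, r < t → X r ω = hist r) ∧ Z ω = z} ≠ 0 →
      P[{ω | X (t + 1) ω = j} |
        {ω | X t ω = i ∧ (∀ r, r < t → X r ω = hist r) ∧ Z ω = z}] = Pmat z i j)
    -- (τ_k) is conditionally independent of X given Z
    (hindep : ∀ z : 𝒵, P {ω | Z ω = z} ≠ 0 →
      ∀ (F G : Finset ℕ) (gaps : ℕ → ℕ) (xs : ℕ → Fin S),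
      P[{ω | (∀ r ∈ F, τ r ω = gaps r) ∧ (∀ t ∈ G, X t ω = xs t)} | {ω | Z ω = z}]
      = P[{ω | ∀ r ∈ F, τ r ω = gaps r} | {ω | Z ω = z}] *
        P[{ω | ∀ t ∈ G, X t ω = xs t} | {ω | Z ω = z}])
    -- the τ_k, k ≥ 1, are conditionally independent given Z = z ...
    (hiid_indep : ∀ z : 𝒵, P {ω | Z ω = z} ≠ 0 →
      ∀ (F : Finset ℕ) (gaps : ℕ → ℕ),
      P[{ω | ∀ r ∈ F, τ r ω = gaps r} | {ω | Z ω = z}]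
      = ∏ r ∈ F, P[{ω | τ r ω = gaps r} | {ω | Z ω = z}])
    -- ... and identically distributed given Z = z
    (hiid_ident : ∀ z : 𝒵, P {ω | Z ω = z} ≠ 0 → ∀ (k : ℕ), 1 ≤ k → ∀ ℓ : ℕ,
      P[{ω | τ k ω = ℓ} | {ω | Z ω = z}] = P[{ω | τ 1 ω = ℓ} | {ω | Z ω = z}]) :
    -- (i) Assumption 2 (conditional memorylessness)
    (∀ (k : ℕ), 1 ≤ k → ∀ (i j : Fin S) (hist : ℕ → Fin S) (ℓ : ℕ)
      (gaps : ℕ → ℕ) (z : 𝒵),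
      P {ω | Y k ω = i ∧ (∀ r, 1 ≤ r → r ≤ k → τ r ω = gaps r) ∧
          (∀ r, 1 ≤ r → r < k → Y r ω = hist r) ∧ Z ω = z} ≠ 0 →
      P[{ω | Y (k + 1) ω = j ∧ τ (k + 1) ω = ℓ} |
        {ω | Y k ω = i ∧ (∀ r, 1 ≤ r → r ≤ k → τ r ω = gaps r) ∧
          (∀ r, 1 ≤ r → r < k → Y r ω = hist r) ∧ Z ω = z}]
      = P[{ω | Y (k + 1) ω = j ∧ τ (k + 1) ω = ℓ} | {ω | Y k ω = i ∧ Z ω = z}]) ∧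
    -- (ii) Assumption 3 (conditional power-transition)
    (∀ (t t' : ℕ), t < t' → ∀ (k : ℕ) (i j : Fin S) (z : 𝒵),
      P {ω | X (T k ω) ω = i ∧ T (k + 1) ω = t' ∧ T k ω = t ∧ Z ω = z} ≠ 0 →
      P[{ω | X (T (k + 1) ω) ω = j} |
        {ω | X (T k ω) ω = i ∧ T (k + 1) ω = t' ∧ T k ω = t ∧ Z ω = z}]
      = (Pmat z ^ (t' - t)) i j) ∧
    -- (iii) Assumption 4 (conditional stationarity of the gap distribution)
    (∀ (k k' : ℕ) (i : Fin S) (ℓ : ℕ) (z : 𝒵),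
      P {ω | Y k ω = i ∧ Z ω = z} ≠ 0 →
      P {ω | Y k' ω = i ∧ Z ω = z} ≠ 0 →
      P[{ω | τ (k + 1) ω = ℓ} | {ω | Y k ω = i ∧ Z ω = z}]
      = P[{ω | τ (k' + 1) ω = ℓ} | {ω | Y k' ω = i ∧ Z ω = z}]) := by
  obtain rfl : T = fun k ω => ∑ r ∈ Finset.Icc 1 k, τ r ω := by
    funext k ω; exact hT k ω
  obtain rfl : Y = fun k ω => X (∑ r ∈ Finset.Icc 1 k, τ r ω) ω := by
    funext k ω; exact hY k ω
  have hmarkov : ∀ (z : 𝒵) (t : ℕ) (x : ℕ → Fin S) (j : Fin S),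
      P[{ω | ∀ r < t + 1, X r ω = x r} ∩ {ω | X (t + 1) ω = j} | {ω | Z ω = z}] =
        P[{ω | ∀ r < t + 1, X r ω = x r} | {ω | Z ω = z}] * Pmat z (x t) j := by
    intro z t x j
    refine measure_inter_eq_of_cond_apply P ?_ (hXmeas _ (measurableSet_singleton j)) ?_
    · simp only [Set.ofPred_forall]
      exact MeasurableSet.iInter fun r => MeasurableSet.iInter fun _ =>
        hXmeas r (measurableSet_singleton _)
    · have hset : {ω | ∀ r < t + 1, X r ω = x r} ∩ {ω | Z ω = z} =
          {ω | X t ω = x t ∧ (∀ r, r < t → X r ω = x r) ∧ Z ω = z} := by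
        ext ω
        simp only [Set.mem_inter_iff, Set.mem_ofPred_eq]
        rw [Nat.forall_lt_succ_right]
        tauto
      rw [hset]
      exact hassump1 t (x t) j x z
  have hnext : ∀ (z : 𝒵), P {ω | Z ω = z} ≠ 0 → ∀ (k : ℕ) (E : Set Ω) (i : Fin S),
      IsPastEvent τ X k E → (∀ ω ∈ E, X (∑ r ∈ Finset.Icc 1 k, τ r ω) ω = i) →
      ∀ (ℓ : ℕ) (j : Fin S),
      P[E ∩ {ω | X (∑ r ∈ Finset.Icc 1 (k + 1), τ r ω) ω = j ∧ τ (k + 1) ω = ℓ} |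
        {ω | Z ω = z}] =
      P[E | {ω | Z ω = z}] *
        (P[{ω | τ 1 ω = ℓ} | {ω | Z ω = z}] * (Pmat z ^ ℓ) i j) := by
    intro z hz k E i hE hi ℓ j
    rw [← hiid_ident z hz (k + 1) (by omega) ℓ]
    exact hE.measure_inter_next hτmeas hXmeas hτpos _ (Pmat z) (hmarkov z) (hindep z hz)
      (hiid_indep z hz) hi ℓ j
  have hsum : ∀ {k : ℕ} {ω ω' : Ω}, (∀ r < k + 1, τ r ω = τ r ω') → ∀ m ≤ k,
      ∑ r ∈ Finset.Icc 1 m, τ r ω = ∑ r ∈ Finset.Icc 1 m, τ r ω' := fun h m hm =>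
    Finset.sum_congr rfl fun r hr => h r (by have := Finset.mem_Icc.1 hr; omega)
  have hmono : ∀ {m k : ℕ} (ω : Ω), m ≤ k →
      ∑ r ∈ Finset.Icc 1 m, τ r ω ≤ ∑ r ∈ Finset.Icc 1 k, τ r ω := fun ω hm =>
    Finset.sum_le_sum_of_subset (Finset.Icc_subset_Icc_right hm)
  have hYpast : ∀ (k : ℕ) (i : Fin S),
      IsPastEvent τ X k {ω | X (∑ r ∈ Finset.Icc 1 k, τ r ω) ω = i} := by
    intro k i ω ω' hω h1 h2
    rw [Set.mem_ofPred_eq, ← hsum h1 k le_rfl, ← h2 _ (by omega)]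
    exact hω
  have hDmeas : ∀ (k ℓ : ℕ) (j : Fin S), MeasurableSet
      {ω | X (∑ r ∈ Finset.Icc 1 (k + 1), τ r ω) ω = j ∧ τ (k + 1) ω = ℓ} := fun k ℓ j =>
    ((hYpast (k + 1) j).measurableSet hτmeas hXmeas).inter
      (hτmeas (k + 1) (measurableSet_singleton ℓ))
  have hgap : ∀ (z : 𝒵), P {ω | Z ω = z} ≠ 0 → ∀ (k : ℕ) (E : Set Ω) (i : Fin S),
      IsPastEvent τ X k E → (∀ ω ∈ E, X (∑ r ∈ Finset.Icc 1 k, τ r ω) ω = i) → ∀ ℓ : ℕ,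
      P[E ∩ {ω | τ (k + 1) ω = ℓ} | {ω | Z ω = z}] =
      P[E | {ω | Z ω = z}] * P[{ω | τ 1 ω = ℓ} | {ω | Z ω = z}] := by
    intro z hz k E i hE hi ℓ
    have hsplit : E ∩ {ω | τ (k + 1) ω = ℓ} = ⋃ j, (E ∩
        {ω | X (∑ r ∈ Finset.Icc 1 (k + 1), τ r ω) ω = j ∧ τ (k + 1) ω = ℓ}) := by
      ext ω; simp
    rw [hsplit, measure_iUnion _
      fun j => (hE.measurableSet hτmeas hXmeas).inter (hDmeas k ℓ j), tsum_fintype,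
      Finset.sum_congr rfl fun j _ => hnext z hz k E i hE hi ℓ j, ← Finset.mul_sum,
      ← Finset.mul_sum, sum_pow_apply_eq_one (hstoch z), mul_one]
    intro j j' hj
    rw [Function.onFun, Set.disjoint_left]
    rintro ω ⟨-, h1, -⟩ ⟨-, h2, -⟩
    exact hj (h1.symm.trans h2)
  have hZ : ∀ {z : 𝒵} {C : Set Ω}, P (C ∩ {ω | Z ω = z}) ≠ 0 → P {ω | Z ω = z} ≠ 0 :=
    fun h h' => h (measure_mono_null Set.inter_subset_right h')
  refine ⟨?_, ?_, ?_⟩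
  · intro k hk i j hist ℓ gaps z h0
    set E : Set Ω := {ω | X (∑ r ∈ Finset.Icc 1 k, τ r ω) ω = i ∧
      (∀ r, 1 ≤ r → r ≤ k → τ r ω = gaps r) ∧
      (∀ r, 1 ≤ r → r < k → X (∑ s ∈ Finset.Icc 1 r, τ s ω) ω = hist r)} with hEdef
    have hE : IsPastEvent τ X k E := by
      rintro ω ω' ⟨h1, h2, h3⟩ h4 h5
      refine ⟨hYpast k i ω ω' h1 h4 h5, fun r hr hr' => ?_, fun r hr hr' => ?_⟩
      · rw [← h4 r (by omega), h2 r hr hr']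
      · have := hmono ω hr'.le
        rw [← hsum h4 r hr'.le, ← h5 _ (by omega), h3 r hr hr']
    have hset : {ω | X (∑ r ∈ Finset.Icc 1 k, τ r ω) ω = i ∧
        (∀ r, 1 ≤ r → r ≤ k → τ r ω = gaps r) ∧
        (∀ r, 1 ≤ r → r < k → X (∑ s ∈ Finset.Icc 1 r, τ s ω) ω = hist r) ∧ Z ω = z} =
        E ∩ {ω | Z ω = z} := by
      ext ω
      simp only [hEdef, Set.mem_inter_iff, Set.mem_ofPred_eq, and_assoc]
    rw [hset] at h0 ⊢
    have h0' : P ({ω | X (∑ r ∈ Finset.Icc 1 k, τ r ω) ω = i} ∩ {ω | Z ω = z}) ≠ 0 := fun h =>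
      h0 (measure_mono_null (Set.inter_subset_inter_left _ fun ω hω => hω.1) h)
    rw [cond_apply_eq_of_measure_inter P (hE.measurableSet hτmeas hXmeas) (hDmeas k ℓ j) h0
      (hnext z (hZ h0) k E i hE (fun ω hω => hω.1) ℓ j)]
    exact (cond_apply_eq_of_measure_inter P ((hYpast k i).measurableSet hτmeas hXmeas)
      (hDmeas k ℓ j) h0' (hnext z (hZ h0) k _ i (hYpast k i) (fun ω hω => hω) ℓ j)).symm
  · intro t t' htt k i j z h0
    set E : Set Ω := {ω | X (∑ r ∈ Finset.Icc 1 k, τ r ω) ω = i ∧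
      ∑ r ∈ Finset.Icc 1 k, τ r ω = t} with hEdef
    have hE : IsPastEvent τ X k E := by
      rintro ω ω' ⟨h1, h2⟩ h3 h4
      exact ⟨hYpast k i ω ω' h1 h3 h4, (hsum h3 k le_rfl).symm.trans h2⟩
    have hset : {ω | X (∑ r ∈ Finset.Icc 1 k, τ r ω) ω = i ∧
        ∑ r ∈ Finset.Icc 1 (k + 1), τ r ω = t' ∧ ∑ r ∈ Finset.Icc 1 k, τ r ω = t ∧ Z ω = z} =
        (E ∩ {ω | τ (k + 1) ω = t' - t}) ∩ {ω | Z ω = z} := by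
      ext ω
      simp only [hEdef, Set.mem_inter_iff, Set.mem_ofPred_eq,
        Finset.sum_Icc_succ_top (show 1 ≤ k + 1 by omega)]
      constructor
      · rintro ⟨h1, h2, h3, h4⟩
        exact ⟨⟨⟨h1, h3⟩, by omega⟩, h4⟩
      · rintro ⟨⟨⟨h1, h3⟩, h2⟩, h4⟩
        exact ⟨h1, by omega, h3, h4⟩
    rw [hset] at h0 ⊢
    have hgapmeas : MeasurableSet {ω | τ (k + 1) ω = t' - t} :=
      hτmeas (k + 1) (measurableSet_singleton _)
    refine cond_apply_eq_of_measure_inter P ((hE.measurableSet hτmeas hXmeas).inter hgapmeas)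
      ((hYpast (k + 1) j).measurableSet hτmeas hXmeas) h0 ?_
    rw [hgap z (hZ h0) k E i hE (fun ω hω => hω.1), mul_assoc,
      ← hnext z (hZ h0) k E i hE (fun ω hω => hω.1), Set.inter_assoc]
    congr 2
    ext ω
    simp [and_comm]
  · have hcond : ∀ (k : ℕ) (i : Fin S) (ℓ : ℕ) (z : 𝒵),
        P ({ω | X (∑ r ∈ Finset.Icc 1 k, τ r ω) ω = i} ∩ {ω | Z ω = z}) ≠ 0 →
        P[{ω | τ (k + 1) ω = ℓ} |
          {ω | X (∑ r ∈ Finset.Icc 1 k, τ r ω) ω = i} ∩ {ω | Z ω = z}] =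
        P[{ω | τ 1 ω = ℓ} | {ω | Z ω = z}] := fun k i ℓ z h0 =>
      cond_apply_eq_of_measure_inter P ((hYpast k i).measurableSet hτmeas hXmeas)
        (hτmeas (k + 1) (measurableSet_singleton ℓ)) h0
        (hgap z (hZ h0) k _ i (hYpast k i) (fun ω hω => hω) ℓ)
    intro k k' i ℓ z h0 h0'
    exact (hcond k i ℓ z h0).trans (hcond k' i ℓ z h0').symm
end

section
/- Let B be a real S×S matrix with B_{ij} ≥ 0 for all i ≠ j and B_{ii} ≤ 0 for all i, and suppose Σ_{j'} |B_{ij'}| > 0 for every row i. Define B̃ by B̃_{ij} = B_{ij} − |B_{ij}| · (Σ_{j'} B_{ij'}) / (Σ_{j'} |B_{ij'}|). Then B̃ is a generator (Q-)matrix: B̃_{ii} ≤ 0 for all i, B̃_{ij} ≥ 0 for all i ≠ j, and Σ_j B̃_{ij} = 0 for every row i. -/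
open Finset

/-- Algorithm 1, weighted adjustment (S2'): applied to a matrix with nonnegative
off-diagonal entries and nonpositive diagonal entries (and with at least one nonzero
entry in each row), it produces a generator (Q-)matrix. -/
theorem regularization_S2prime_generator (S : ℕ) (B : Matrix (Fin S) (Fin S) ℝ)
    (hoff : ∀ i j : Fin S, i ≠ j → 0 ≤ B i j) (hdiag : ∀ i, B i i ≤ 0)
    (habs : ∀ i, 0 < ∑ j', |B i j'|)
    (Bt : Matrix (Fin S) (Fin S) ℝ)
    (hBt : ∀ i j : Fin S, Bt i j =
      B i j - |B i j| * ((∑ j', B i j') / (∑ j', |B i j'|))) :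
    (∀ i, Bt i i ≤ 0) ∧ (∀ i j, i ≠ j → 0 ≤ Bt i j) ∧ (∀ i, ∑ j, Bt i j = 0) := by
  have ratio_bounds (i : Fin S) :
      -1 ≤ (∑ j', B i j') / (∑ j', |B i j'|) ∧ (∑ j', B i j') / (∑ j', |B i j'|) ≤ 1 := by
    rw [← abs_le, abs_div, abs_of_pos (habs i)]
    exact div_le_one_of_le₀ (abs_sum_le_sum_abs _ _) (habs i).le
  refine ⟨fun i => ?_, fun i j hij => ?_, fun i => ?_⟩
  · rw [hBt, abs_of_nonpos (hdiag i)]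
    nlinarith [(ratio_bounds i).1, hdiag i]
  · rw [hBt, abs_of_nonneg (hoff i j hij)]
    nlinarith [(ratio_bounds i).2, hoff i j hij]
  · simp_rw [hBt]
    rw [sum_sub_distrib, ← sum_mul, mul_div_cancel₀ _ (habs i).ne', sub_self]
end

section
/- (Lipschitz stability of the integral representation of the matrix logarithm, inequality (A.63) in the paper.) Let n ≥ 1, let A and B be real n×n matrices, and let M ≥ 1 be such that for every t ∈ [0,1] the matrices t(A − I) + I and t(B − I) + I are invertible with ‖(t(A − I) + I)^{−1}‖ ≤ M and ‖(t(B − I) + I)^{−1}‖ ≤ M, where ‖·‖ is a submultiplicative matrix norm with ‖I‖ bounded. Define L(X) = (X − I) ∫₀¹ (t(X − I) + I)^{−1} dt for X ∈ {A, B} (a Bochner integral of a continuous matrix-valued function). Then ‖L(A) − L(B)‖ ≤ M ‖A − B‖ + (‖B − I‖ M² / 2) ‖A − B‖; in particular there is a constant C depending only on M and ‖B − I‖ such that ‖L(A) − L(B)‖ ≤ C ‖A − B‖. -/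
open MeasureTheory intervalIntegral

attribute [local instance] Matrix.linftyOpNormedAddCommGroup Matrix.linftyOpNormedRing
  Matrix.linftyOpNormedSpace Matrix.linftyOpNormedAlgebra

/-- The second resolvent identity, in norm. -/
theorem norm_sub_le_of_mul_eq_one {E : Type*} [NormedRing E] {x y p q : E} {M : ℝ}
    (hp : p * x = 1) (hq : y * q = 1) (hpM : ‖p‖ ≤ M) (hqM : ‖q‖ ≤ M) :
    ‖p - q‖ ≤ M ^ 2 * ‖y - x‖ := by
  have hM : 0 ≤ M := (norm_nonneg p).trans hpM
  have key : p - q = p * (y - x) * q := by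
    rw [mul_sub, sub_mul, hp, one_mul, mul_assoc, hq, mul_one]
  calc ‖p - q‖ ≤ ‖p‖ * ‖y - x‖ * ‖q‖ := by
        rw [key]
        exact norm_mul₃_le
    _ ≤ M * ‖y - x‖ * M := by gcongr
    _ = M ^ 2 * ‖y - x‖ := by ring

/-- A bounded family of inverses of the segment `t • (a - 1) + 1` is continuous. -/
theorem continuousOn_of_inverse_segment {E : Type*} [NormedRing E] [NormedAlgebra ℝ E]
    {a : E} {R : ℝ → E} {M : ℝ} {s : Set ℝ}
    (hl : ∀ t ∈ s, R t * (t • (a - 1) + 1) = 1) (hr : ∀ t ∈ s, (t • (a - 1) + 1) * R t = 1)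
    (hM : ∀ t ∈ s, ‖R t‖ ≤ M) : ContinuousOn R s := by
  refine (LipschitzOnWith.of_dist_le_mul (K := (M ^ 2 * ‖a - 1‖).toNNReal) ?_).continuousOn
  intro t ht u hu
  rw [dist_eq_norm, Real.coe_toNNReal _ (by positivity), Real.dist_eq]
  refine (norm_sub_le_of_mul_eq_one (hl t ht) (hr u hu) (hM t ht) (hM u hu)).trans_eq ?_
  rw [add_sub_add_right_eq_sub, ← sub_smul, norm_smul, Real.norm_eq_abs, abs_sub_comm]
  ring

/-- Lipschitz stability of `x ↦ (x - 1) * ∫₀¹ (t • (x - 1) + 1)⁻¹ dt` in a normed algebra,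
where the inverses are given by functions `R` and `S`. -/
theorem norm_mul_integral_sub_mul_integral_le {E : Type*} [NormedRing E] [NormedAlgebra ℝ E]
    {a b : E} {R S : ℝ → E} {M : ℝ}
    (hRl : ∀ t ∈ Set.Icc (0 : ℝ) 1, R t * (t • (a - 1) + 1) = 1)
    (hRr : ∀ t ∈ Set.Icc (0 : ℝ) 1, (t • (a - 1) + 1) * R t = 1)
    (hRM : ∀ t ∈ Set.Icc (0 : ℝ) 1, ‖R t‖ ≤ M)
    (hSl : ∀ t ∈ Set.Icc (0 : ℝ) 1, S t * (t • (b - 1) + 1) = 1)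
    (hSr : ∀ t ∈ Set.Icc (0 : ℝ) 1, (t • (b - 1) + 1) * S t = 1)
    (hSM : ∀ t ∈ Set.Icc (0 : ℝ) 1, ‖S t‖ ≤ M) :
    ‖(a - 1) * (∫ t in (0 : ℝ)..1, R t) - (b - 1) * ∫ t in (0 : ℝ)..1, S t‖ ≤
      M * ‖a - b‖ + ‖b - 1‖ * M ^ 2 / 2 * ‖a - b‖ := by
  have hRi : IntervalIntegrable R volume 0 1 :=
    (continuousOn_of_inverse_segment hRl hRr hRM).intervalIntegrable_of_Icc zero_le_one
  have hSi : IntervalIntegrable S volume 0 1 :=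
    (continuousOn_of_inverse_segment hSl hSr hSM).intervalIntegrable_of_Icc zero_le_one
  have hR : ‖∫ t in (0 : ℝ)..1, R t‖ ≤ M := by
    have h := norm_integral_le_of_norm_le_const (f := R) (a := 0) (b := 1) (C := M)
      fun t ht => hRM t (Set.Ioc_subset_Icc_self (Set.uIoc_of_le (zero_le_one' ℝ) ▸ ht))
    simpa using h
  have hRS : ‖(∫ t in (0 : ℝ)..1, R t) - ∫ t in (0 : ℝ)..1, S t‖ ≤ M ^ 2 / 2 * ‖a - b‖ := by
    rw [← integral_sub hRi hSi]
    calc ‖∫ t in (0 : ℝ)..1, (R t - S t)‖ ≤ ∫ t in (0 : ℝ)..1, t * (M ^ 2 * ‖a - b‖) := by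
          refine norm_integral_le_of_norm_le zero_le_one (ae_of_all _ fun t ht => ?_)
            (Continuous.intervalIntegrable (by fun_prop) _ _)
          have ht' := Set.Ioc_subset_Icc_self ht
          refine (norm_sub_le_of_mul_eq_one (hRl t ht') (hSr t ht') (hRM t ht')
            (hSM t ht')).trans_eq ?_
          rw [add_sub_add_right_eq_sub, ← smul_sub, sub_sub_sub_cancel_right, norm_smul,
            Real.norm_of_nonneg ht'.1, norm_sub_rev]
          ring
      _ = M ^ 2 / 2 * ‖a - b‖ := by
          rw [intervalIntegral.integral_mul_const, integral_id]
          ring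
  calc _ = ‖(a - b) * (∫ t in (0 : ℝ)..1, R t) +
        (b - 1) * ((∫ t in (0 : ℝ)..1, R t) - ∫ t in (0 : ℝ)..1, S t)‖ := by
        congr 1
        noncomm_ring
    _ ≤ ‖a - b‖ * M + ‖b - 1‖ * (M ^ 2 / 2 * ‖a - b‖) :=
        norm_add_le_of_le (norm_mul_le_of_le le_rfl hR) (norm_mul_le_of_le le_rfl hRS)
    _ = _ := by ring

/-- Lipschitz stability of the integral representation of the matrix logarithm
(inequality (A.63) of the paper): if `L(X) = (X − I) ∫₀¹ (t(X − I) + I)⁻¹ dt` and the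
resolvents of `A` and `B` are uniformly bounded by `M` on `[0,1]`, then
`‖L(A) − L(B)‖ ≤ M ‖A − B‖ + ‖B − I‖ M²/2 ‖A − B‖` (in a submultiplicative matrix
norm, here the `L∞` operator norm). -/
theorem log_integral_representation_lipschitz (n : ℕ) (hn : 1 ≤ n)
    (A B : Matrix (Fin n) (Fin n) ℝ) (M : ℝ) (hM : 1 ≤ M)
    (hA : ∀ t ∈ Set.Icc (0 : ℝ) 1,
      IsUnit (t • (A - 1) + 1) ∧ ‖(t • (A - 1) + 1)⁻¹‖ ≤ M)
    (hB : ∀ t ∈ Set.Icc (0 : ℝ) 1,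
      IsUnit (t • (B - 1) + 1) ∧ ‖(t • (B - 1) + 1)⁻¹‖ ≤ M)
    (LA LB : Matrix (Fin n) (Fin n) ℝ)
    (hLA : LA = (A - 1) * ∫ t in (0 : ℝ)..1, (t • (A - 1) + 1)⁻¹)
    (hLB : LB = (B - 1) * ∫ t in (0 : ℝ)..1, (t • (B - 1) + 1)⁻¹) :
    ‖LA - LB‖ ≤ M * ‖A - B‖ + ‖B - 1‖ * M ^ 2 / 2 * ‖A - B‖ := by
  have inv_left : ∀ X : Matrix (Fin n) (Fin n) ℝ, IsUnit X → X⁻¹ * X = 1 := fun X h =>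
    Matrix.nonsing_inv_mul X ((Matrix.isUnit_iff_isUnit_det X).1 h)
  have inv_right : ∀ X : Matrix (Fin n) (Fin n) ℝ, IsUnit X → X * X⁻¹ = 1 := fun X h =>
    Matrix.mul_nonsing_inv X ((Matrix.isUnit_iff_isUnit_det X).1 h)
  subst hLA hLB
  exact norm_mul_integral_sub_mul_integral_le
    (fun t ht => inv_left _ (hA t ht).1) (fun t ht => inv_right _ (hA t ht).1)
    (fun t ht => (hA t ht).2)
    (fun t ht => inv_left _ (hB t ht).1) (fun t ht => inv_right _ (hB t ht).1)
    (fun t ht => (hB t ht).2)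
end
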